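/- Let m ≥ 1 be an integer, ε > 0, α ∈ (0,1), β ∈ (0,1), and let s be an integer with s ≥ 16 log(20m/(αβ))/α² + 16 log(20m/(αβ))/(αε). Then there exists a randomized mechanism A mapping datasets of s samples in {0,1,...,m} to probability measures on [0,1] such that: (i) A is (ε,0)-differentially private with respect to single-coordinate adjacency (for any two datasets differing in one sample and any measurable S ⊆ [0,1], the output probabilities satisfy the e^ε multiplicative bound); and (ii) for every p ∈ [0,1], when the s samples are drawn i.i.d. from Bin(m,p), the output p̂ of A satisfies with probability at least 1 − β that |p − p̂| ≤ α · max( 1/m, √(p(1−p))/√m ). -/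

import Mathlib

open MeasureTheory ProbabilityTheory
open scoped ENNReal NNReal

/-- The probability mass function of the binomial distribution `Bin(m,p)` at `j`. -/
noncomputable def binomPMF (m : ℕ) (p : ℝ) (j : ℕ) : ℝ :=
  (m.choose j : ℝ) * p ^ j * (1 - p) ^ (m - j)

/-- The binomial distribution `Bin(m,p)` as a measure on `{0, 1, …, m}`. -/
noncomputable def binMeasure (m : ℕ) (p : ℝ) : Measure (Fin (m + 1)) :=
  ∑ j : Fin (m + 1), ENNReal.ofReal (binomPMF m p j) • Measure.dirac j

/-! ### Binomial expectations -/

/-- The expectation of `g` under `Bin(m,r)`, by conditioning on one trial at a time. -/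
def binomExp (r : ℝ) : ℕ → (ℕ → ℝ) → ℝ
  | 0, g => g 0
  | m + 1, g => (1 - r) * binomExp r m g + r * binomExp r m (fun j => g (j + 1))

theorem sum_binomPMF_mul (r : ℝ) (m : ℕ) (g : ℕ → ℝ) :
    ∑ j ∈ Finset.range (m + 1), binomPMF m r j * g j = binomExp r m g := by
  induction m generalizing g with
  | zero => simp [binomPMF, binomExp]
  | succ m ih =>
    rw [binomExp, ← ih, ← ih, Finset.sum_range_succ' _ (m + 1)]
    have hsplit : ∀ j ∈ Finset.range (m + 1), binomPMF (m + 1) r (j + 1) * g (j + 1) =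
        r * (binomPMF m r j * g (j + 1)) +
          (m.choose (j + 1) : ℝ) * r ^ (j + 1) * (1 - r) ^ (m - j) * g (j + 1) := by
      intro j _
      simp only [binomPMF, Nat.choose_succ_succ, Nat.add_sub_add_right]
      push_cast
      ring
    have hshift : ∑ j ∈ Finset.range (m + 1),
        (m.choose (j + 1) : ℝ) * r ^ (j + 1) * (1 - r) ^ (m - j) * g (j + 1) =
          (1 - r) * ∑ j ∈ Finset.range m, binomPMF m r (j + 1) * g (j + 1) := by
      rw [Finset.sum_range_succ, Nat.choose_succ_self, Finset.mul_sum]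
      simp only [Nat.cast_zero, zero_mul, add_zero]
      refine Finset.sum_congr rfl fun j hj => ?_
      have hj' : m - j = m - (j + 1) + 1 := by have := Finset.mem_range.mp hj; omega
      simp only [binomPMF, hj', pow_succ]
      ring
    rw [Finset.sum_congr rfl hsplit, Finset.sum_add_distrib, ← Finset.mul_sum, hshift,
      Finset.sum_range_succ' (fun j => binomPMF m r j * g j) m]
    simp only [binomPMF, Nat.choose_zero_right, pow_zero, Nat.sub_zero, pow_succ]
    push_cast
    ring

theorem binomExp_const (r : ℝ) (m : ℕ) (c : ℝ) : binomExp r m (fun _ => c) = c := by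
  induction m with
  | zero => rfl
  | succ m ih => rw [binomExp, ih]; ring

theorem binomExp_add (r : ℝ) (m : ℕ) (f g : ℕ → ℝ) :
    binomExp r m (fun j => f j + g j) = binomExp r m f + binomExp r m g := by
  induction m generalizing f g with
  | zero => rfl
  | succ m ih =>
    simp only [binomExp]
    rw [ih, ih (fun j => f (j + 1))]
    ring

theorem binomExp_const_mul (r : ℝ) (m : ℕ) (c : ℝ) (f : ℕ → ℝ) :
    binomExp r m (fun j => c * f j) = c * binomExp r m f := by
  induction m generalizing f with
  | zero => rfl
  | succ m ih =>
    simp only [binomExp]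
    rw [ih, ih (fun j => f (j + 1))]
    ring

theorem binomExp_sub (r : ℝ) (m : ℕ) (f g : ℕ → ℝ) :
    binomExp r m (fun j => f j - g j) = binomExp r m f - binomExp r m g := by
  have h := binomExp_add r m f (fun j => (-1) * g j)
  rw [binomExp_const_mul] at h
  simpa [sub_eq_add_neg] using h

theorem binomExp_mono {r : ℝ} (h0 : 0 ≤ r) (h1 : r ≤ 1) (m : ℕ) {f g : ℕ → ℝ}
    (hfg : ∀ j, f j ≤ g j) : binomExp r m f ≤ binomExp r m g := by
  induction m generalizing f g with
  | zero => exact hfg 0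
  | succ m ih =>
    exact add_le_add (mul_le_mul_of_nonneg_left (ih hfg) (by linarith))
      (mul_le_mul_of_nonneg_left (ih fun j => hfg (j + 1)) h0)

theorem binomExp_sub_sq (r : ℝ) (m : ℕ) (a : ℝ) :
    binomExp r m (fun j => ((j : ℝ) - a) ^ 2) = m * r * (1 - r) + (m * r - a) ^ 2 := by
  induction m generalizing a with
  | zero => simp [binomExp]
  | succ m ih =>
    have hs : (fun j : ℕ => (((j + 1 : ℕ) : ℝ) - a) ^ 2) =
        fun j : ℕ => ((j : ℝ) - (a - 1)) ^ 2 := by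
      funext j; push_cast; ring
    rw [binomExp, ih, hs, ih]
    push_cast
    ring

theorem binomExp_sub_binomExp_sq_le {r : ℝ} (m : ℕ) (f : ℕ → ℝ) (a : ℝ) :
    binomExp r m (fun j => (f j - binomExp r m f) ^ 2) ≤
      binomExp r m (fun j => (f j - a) ^ 2) := by
  set μ := binomExp r m f with hμ
  have h : (fun j => (f j - a) ^ 2) =
      fun j => (f j - μ) ^ 2 + (2 * (μ - a) * f j + (a ^ 2 - μ ^ 2)) := by
    funext j; ring
  rw [h, binomExp_add, binomExp_add, binomExp_const_mul, binomExp_const, ← hμ]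
  nlinarith [sq_nonneg (μ - a)]

theorem hasDerivAt_binomExp (m : ℕ) (g : ℕ → ℝ) (r : ℝ) :
    HasDerivAt (fun r => binomExp r (m + 1) g)
      ((m + 1) * binomExp r m (fun j => g (j + 1) - g j)) r := by
  induction m generalizing g with
  | zero =>
    simp only [binomExp]
    have h := (((hasDerivAt_id r).const_sub 1).mul_const (g 0)).add
      ((hasDerivAt_id r).mul_const (g (0 + 1)))
    refine h.congr_deriv ?_
    push_cast
    ring
  | succ m ih =>
    have h := (((hasDerivAt_id r).const_sub 1).mul (ih g)).add
      ((hasDerivAt_id r).mul (ih fun j => g (j + 1)))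
    refine HasDerivAt.congr_deriv (f := fun r => binomExp r (m + 1 + 1) g) h ?_
    have e : binomExp r (m + 1) (fun j => g (j + 1) - g j) =
        (1 - r) * binomExp r m (fun j => g (j + 1) - g j) +
          r * binomExp r m (fun j => g (j + 1 + 1) - g (j + 1)) := rfl
    have e' := binomExp_sub r (m + 1) (fun j => g (j + 1)) g
    simp only [id]
    push_cast
    linear_combination (-(m : ℝ) - 1) * e - e'

theorem monotoneOn_binomExp (m : ℕ) {g : ℕ → ℝ} (hg : Monotone g) :
    MonotoneOn (fun r => binomExp r m g) (Set.Icc 0 1) := by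
  cases m with
  | zero => exact fun _ _ _ _ _ => le_rfl
  | succ m =>
    refine monotoneOn_of_deriv_nonneg (convex_Icc 0 1)
      (fun r _ => (hasDerivAt_binomExp m g r).continuousAt.continuousWithinAt)
      (fun r _ => (hasDerivAt_binomExp m g r).differentiableAt.differentiableWithinAt) ?_
    intro r hr
    rw [interior_Icc] at hr
    rw [(hasDerivAt_binomExp m g r).deriv]
    refine mul_nonneg (by positivity) ?_
    have := binomExp_mono hr.1.le hr.2.le m (f := fun _ => 0) (g := fun j => g (j + 1) - g j)
      (fun j => sub_nonneg.mpr (hg (Nat.le_succ j)))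
    rwa [binomExp_const] at this

/-- Bernstein-type bound on the exponential moments of a `[0,1]`-valued statistic. -/
theorem binomExp_exp_le {r : ℝ} (h0 : 0 ≤ r) (h1 : r ≤ 1) (m : ℕ) (f : ℕ → ℝ)
    (hf0 : ∀ j, 0 ≤ f j) (hf1 : ∀ j, f j ≤ 1) (l : ℝ) (hl : |l| ≤ 1 / 2) :
    binomExp r m (fun j => Real.exp (l * f j)) ≤
      Real.exp (l * binomExp r m f +
        0.6 * l ^ 2 * binomExp r m (fun j => (f j - binomExp r m f) ^ 2)) := by
  set μ := binomExp r m f with hμ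
  have hμ0 : 0 ≤ μ := by simpa [binomExp_const] using binomExp_mono h0 h1 m hf0
  have hμ1 : μ ≤ 1 := by simpa [binomExp_const] using binomExp_mono h0 h1 m hf1
  have hexp : ∀ x : ℝ, |x| ≤ 1 / 2 → Real.exp x ≤ 1 + x + 0.6 * x ^ 2 := by
    intro x hx
    have h := Real.exp_bound (x := x) (by linarith) (n := 4) (by norm_num)
    simp only [Finset.sum_range_succ, Finset.sum_range_zero] at h
    norm_num [Nat.factorial] at h
    have h2 := (abs_le.mp h).2
    have hx2 := abs_le.mp hx
    have h4 : |x| ^ 4 = x ^ 4 := by rw [← abs_pow, abs_of_nonneg (by positivity)]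
    rw [h4] at h2
    nlinarith [sq_nonneg x, mul_nonneg (sq_nonneg x) (sub_nonneg.mpr hx2.2),
      mul_nonneg (mul_nonneg (sq_nonneg x) (sub_nonneg.mpr hx2.2)) (by linarith : 0 ≤ x + 1/2)]
  have hle : ∀ j, Real.exp (l * f j) ≤
      Real.exp (l * μ) * (1 + l * (f j - μ) + 0.6 * l ^ 2 * (f j - μ) ^ 2) := by
    intro j
    have hab : |l * (f j - μ)| ≤ 1 / 2 := by
      rw [abs_mul]
      have : |f j - μ| ≤ 1 := abs_le.mpr ⟨by linarith [hf0 j], by linarith [hf1 j]⟩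
      nlinarith [abs_nonneg l, abs_nonneg (f j - μ)]
    have := hexp _ hab
    rw [show l * f j = l * μ + l * (f j - μ) by ring, Real.exp_add]
    refine mul_le_mul_of_nonneg_left (this.trans_eq (by ring)) (Real.exp_pos _).le
  refine (binomExp_mono h0 h1 m hle).trans ?_
  rw [binomExp_const_mul, binomExp_add, binomExp_add, binomExp_const_mul, binomExp_const_mul,
    binomExp_sub, binomExp_const, binomExp_const, ← hμ, sub_self, mul_zero, add_zero,
    Real.exp_add]
  refine mul_le_mul_of_nonneg_left ?_ (Real.exp_pos _).le
  linarith [Real.add_one_le_exp (0.6 * l ^ 2 * binomExp r m (fun j => (f j - μ) ^ 2))]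

/-! ### The test statistic -/

/-- A `C¹` piecewise cubic step rising from `0` at `-1` to `1` at `1`. -/
noncomputable def smoothStep (u : ℝ) : ℝ :=
  1 / 2 + 3 / 4 * (max (-1) (min 1 u) - max (-1) (min 1 u) ^ 3 / 3)

theorem smoothStep_eq_cubic {u : ℝ} (h1 : -1 ≤ u) (h2 : u ≤ 1) :
    smoothStep u = 1 / 2 + 3 / 4 * (u - u ^ 3 / 3) := by
  rw [smoothStep, min_eq_right h2, max_eq_right h1]

theorem smoothStep_eq_one {u : ℝ} (h : 1 ≤ u) : smoothStep u = 1 := by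
  rw [smoothStep, min_eq_left h]; norm_num

theorem smoothStep_eq_zero {u : ℝ} (h : u ≤ -1) : smoothStep u = 0 := by
  rw [smoothStep, min_eq_right (by linarith), max_eq_left h]; norm_num

theorem smoothStep_sub_bounds {u v : ℝ} (h : u ≤ v) :
    0 ≤ smoothStep v - smoothStep u ∧ smoothStep v - smoothStep u ≤ 3 / 4 * (v - u) := by
  set a := max (-1) (min 1 u) with ha
  set b := max (-1) (min 1 v) with hb
  have hab : a ≤ b := max_le_max le_rfl (min_le_min le_rfl h)
  have hba : b - a ≤ v - u := by
    rw [ha, hb]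
    rcases max_cases (-1) (min 1 u) with h1 | h1 <;> rcases min_cases 1 u with h2 | h2 <;>
      rcases max_cases (-1) (min 1 v) with h3 | h3 <;> rcases min_cases 1 v with h4 | h4 <;>
      linarith
  have ha1 : -1 ≤ a := le_max_left _ _
  have hb1 : b ≤ 1 := max_le (by norm_num) (min_le_left _ _)
  have he : smoothStep v - smoothStep u =
      3 / 4 * ((b - a) * (1 - (a ^ 2 + a * b + b ^ 2) / 3)) := by
    simp only [smoothStep, ← ha, ← hb]; ring
  rw [he]
  constructor
  · refine mul_nonneg (by norm_num) (mul_nonneg (by linarith) ?_)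
    nlinarith [mul_nonneg (by linarith : 0 ≤ a + 1) (by linarith : 0 ≤ 1 - b),
      mul_nonneg (by linarith : 0 ≤ a + 1) (by linarith : 0 ≤ 1 - a),
      mul_nonneg (by linarith : 0 ≤ b + 1) (by linarith : 0 ≤ 1 - b), sq_nonneg (a - b)]
  · nlinarith [mul_nonneg (by linarith : 0 ≤ b - a)
      (by nlinarith [sq_nonneg (a + b), sq_nonneg a, sq_nonneg b] : 0 ≤ a ^ 2 + a * b + b ^ 2)]

theorem smoothStep_mono : Monotone smoothStep := fun _ _ h =>
  sub_nonneg.mp (smoothStep_sub_bounds h).1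

theorem smoothStep_nonneg (u : ℝ) : 0 ≤ smoothStep u := by
  rw [← smoothStep_eq_zero (min_le_right u (-1))]
  exact smoothStep_mono (min_le_left _ _)

theorem smoothStep_le_one (u : ℝ) : smoothStep u ≤ 1 := by
  rw [← smoothStep_eq_one (le_max_right u 1)]
  exact smoothStep_mono (le_max_left _ _)

theorem abs_smoothStep_sub_le (u v : ℝ) : |smoothStep u - smoothStep v| ≤ 3 / 4 * |u - v| := by
  rcases le_total u v with h | h
  · have := smoothStep_sub_bounds h
    rw [abs_sub_comm, abs_sub_comm u, abs_of_nonneg this.1, abs_of_nonneg (by linarith)]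
    exact this.2
  · have := smoothStep_sub_bounds h
    rw [abs_of_nonneg this.1, abs_of_nonneg (by linarith)]
    exact this.2

theorem cubic_sub_le_smoothStep_sub {u v : ℝ} (h : u ≤ v) :
    3 / 4 * ((v - v ^ 3 / 3) - (u - u ^ 3 / 3)) ≤ smoothStep v - smoothStep u := by
  have hlo : ∀ x ≤ (-1 : ℝ), ∀ y ≤ (-1 : ℝ), x ≤ y → y - y ^ 3 / 3 ≤ x - x ^ 3 / 3 := by
    intro x hx y hy hxy
    nlinarith [mul_nonneg (by linarith : 0 ≤ y - x)
      (by nlinarith : 0 ≤ x ^ 2 + x * y + y ^ 2 - 3)]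
  have hhi : ∀ x ≥ (1 : ℝ), ∀ y ≥ (1 : ℝ), x ≤ y → y - y ^ 3 / 3 ≤ x - x ^ 3 / 3 := by
    intro x hx y hy hxy
    nlinarith [mul_nonneg (by linarith : 0 ≤ y - x)
      (by nlinarith : 0 ≤ x ^ 2 + x * y + y ^ 2 - 3)]
  rcases le_total u (-1) with hu | hu <;> rcases le_total v (-1) with hv | hv
  · rw [smoothStep_eq_zero hu, smoothStep_eq_zero hv]
    linarith [hlo u hu v hv h]
  · have h1 := hlo u hu (-1) le_rfl hu
    rcases le_total v 1 with hv' | hv'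
    · rw [smoothStep_eq_zero hu, smoothStep_eq_cubic hv hv']; linarith
    · have h2 := hhi 1 le_rfl v hv' hv'
      rw [smoothStep_eq_zero hu, smoothStep_eq_one hv']; linarith
  · have : u = v := by linarith
    simp [this]
  · rcases le_total u 1 with hu' | hu' <;> rcases le_total v 1 with hv' | hv'
    · rw [smoothStep_eq_cubic hu hu', smoothStep_eq_cubic hv hv']; linarith
    · have h2 := hhi 1 le_rfl v hv' hv'
      rw [smoothStep_eq_cubic hu hu', smoothStep_eq_one hv']; linarith
    · have : u = v := by linarith
      simp [this]
    · rw [smoothStep_eq_one hu', smoothStep_eq_one hv']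
      linarith [hhi u hu' v hv' h]

/-- The standard deviation of `Bin(m,q)`, truncated below at `1`. -/
noncomputable def binomWidth (m : ℕ) (q : ℝ) : ℝ := max 1 (Real.sqrt (m * q * (1 - q)))

theorem one_le_binomWidth (m : ℕ) (q : ℝ) : 1 ≤ binomWidth m q := le_max_left _ _

theorem binomWidth_pos (m : ℕ) (q : ℝ) : 0 < binomWidth m q :=
  one_pos.trans_le (one_le_binomWidth m q)

theorem variance_le_binomWidth_sq (m : ℕ) (q : ℝ) : m * q * (1 - q) ≤ binomWidth m q ^ 2 := by
  rw [← Real.sqrt_le_left (binomWidth_pos m q).le]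
  exact le_max_right _ _

theorem continuous_binomWidth (m : ℕ) : Continuous (binomWidth m) := by
  unfold binomWidth; fun_prop

theorem variance_sub_le (m : ℕ) {q r : ℝ} (hq0 : 0 ≤ q) (hq1 : q ≤ 1) (hr0 : 0 ≤ r)
    (hr1 : r ≤ 1) : m * q * (1 - q) ≤ m * r * (1 - r) + m * |q - r| := by
  have h : q * (1 - q) ≤ r * (1 - r) + |q - r| := by
    have h1 : |q - r| * |1 - q - r| ≤ |q - r| :=
      mul_le_of_le_one_right (abs_nonneg _) (abs_le.mpr ⟨by linarith, by linarith⟩)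
    rw [← abs_mul] at h1
    have := le_abs_self ((q - r) * (1 - q - r))
    nlinarith
  have := mul_le_mul_of_nonneg_left h (Nat.cast_nonneg (α := ℝ) m)
  linarith

theorem binomWidth_sq_le (m : ℕ) {q r : ℝ} (hq0 : 0 ≤ q) (hq1 : q ≤ 1) (hr0 : 0 ≤ r)
    (hr1 : r ≤ 1) : binomWidth m q ^ 2 ≤ binomWidth m r ^ 2 + m * |q - r| := by
  have h0 : 0 ≤ (m : ℝ) * |q - r| := by positivity
  have h1 := one_le_binomWidth m r
  rcases max_choice 1 (Real.sqrt (m * q * (1 - q))) with h | h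
  · rw [binomWidth, h]; nlinarith
  · rw [binomWidth, h, Real.sq_sqrt (mul_nonneg (by positivity) (by linarith))]
    linarith [variance_sub_le m hq0 hq1 hr0 hr1, variance_le_binomWidth_sq m r]

/-- A smoothed threshold statistic of one `Bin(n+1,·)` sample, centred for `Bin(n+1,q)`. -/
noncomputable def testStat (n : ℕ) (q : ℝ) (j : ℕ) : ℝ :=
  smoothStep ((j - (n * q + 1 / 2)) / (3 * binomWidth (n + 1) q))

theorem testStat_mono (n : ℕ) (q : ℝ) : Monotone (testStat n q) := by
  intro i j hij
  have := binomWidth_pos (n + 1) q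
  have hij' : (i : ℝ) ≤ j := by exact_mod_cast hij
  apply smoothStep_mono
  gcongr

theorem testStat_succ_sub_ge (n : ℕ) (q : ℝ) (j : ℕ) :
    1 / (4 * binomWidth (n + 1) q) *
      (1 - (((j : ℝ) - n * q) ^ 2 + 1 / 12) / (9 * binomWidth (n + 1) q ^ 2)) ≤
      testStat n q (j + 1) - testStat n q j := by
  have hw := binomWidth_pos (n + 1) q
  unfold testStat
  set w := binomWidth (n + 1) q
  refine le_trans (le_of_eq ?_) (cubic_sub_le_smoothStep_sub ?_)
  · push_cast
    field_simp
    ring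
  · gcongr
    linarith

theorem binomExp_testStat_succ_sub_ge (n : ℕ) {q r : ℝ} (hr0 : 0 ≤ r) (hr1 : r ≤ 1) :
    1 / (4 * binomWidth (n + 1) q) *
      (1 - (n * r * (1 - r) + (n * r - n * q) ^ 2 + 1 / 12) / (9 * binomWidth (n + 1) q ^ 2)) ≤
      binomExp r n (fun j => testStat n q (j + 1) - testStat n q j) := by
  refine le_trans (le_of_eq ?_) (binomExp_mono hr0 hr1 n (testStat_succ_sub_ge n q))
  rw [binomExp_const_mul, binomExp_sub, binomExp_const]
  simp only [div_eq_inv_mul _ (9 * binomWidth (n + 1) q ^ 2)]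
  rw [binomExp_const_mul, binomExp_add, binomExp_const, binomExp_sub_sq]

theorem binomExp_testStat_variance_le (n : ℕ) {q r : ℝ} (hr0 : 0 ≤ r) (hr1 : r ≤ 1) :
    binomExp r (n + 1)
        (fun j => (testStat n q j - binomExp r (n + 1) (testStat n q)) ^ 2) ≤
      binomWidth (n + 1) r ^ 2 / (16 * binomWidth (n + 1) q ^ 2) := by
  have hw := binomWidth_pos (n + 1) q
  refine (binomExp_sub_binomExp_sq_le (n + 1) (testStat n q)
    (smoothStep (((n + 1 : ℕ) * r - (n * q + 1 / 2)) / (3 * binomWidth (n + 1) q)))).trans ?_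
  refine (binomExp_mono hr0 hr1 (n + 1) (g := fun j =>
    (16 * binomWidth (n + 1) q ^ 2)⁻¹ * ((j : ℝ) - (n + 1 : ℕ) * r) ^ 2) fun j => ?_).trans ?_
  · have h := abs_smoothStep_sub_le ((j - (n * q + 1 / 2)) / (3 * binomWidth (n + 1) q))
      (((n + 1 : ℕ) * r - (n * q + 1 / 2)) / (3 * binomWidth (n + 1) q))
    have h2 := pow_le_pow_left₀ (abs_nonneg _) h 2
    rw [sq_abs, mul_pow, sq_abs] at h2
    refine h2.trans_eq ?_
    field_simp
    ring
  · rw [binomExp_const_mul, binomExp_sub_sq, sub_self, div_eq_inv_mul]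
    gcongr
    linarith [variance_le_binomWidth_sq (n + 1) r]

/-- The mean of the test statistic at `q` moves by a definite amount when `q` does. -/
theorem binomExp_testStat_gain (n : ℕ) {q q' σ D : ℝ} (hσ : σ = 1 ∨ σ = -1) (hD : 0 ≤ D)
    (hq0 : 0 ≤ q) (hq1 : q ≤ 1) (hq' : q' = q + σ * (D / (n + 1))) (hq'0 : 0 ≤ q')
    (hq'1 : q' ≤ 1) :
    D / (4 * binomWidth (n + 1) q) *
      (1 - (binomWidth (n + 1) q' ^ 2 + D / 2 + D ^ 2 / 3 + 1 / 12) /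
        (9 * binomWidth (n + 1) q ^ 2)) ≤
      σ * (binomExp q' (n + 1) (testStat n q) - binomExp q (n + 1) (testStat n q)) := by
  have hw := binomWidth_pos (n + 1) q
  have hw' := variance_le_binomWidth_sq (n + 1) q'
  set w := binomWidth (n + 1) q with hwdef
  set u := binomWidth (n + 1) q' with hudef
  have hσ2 : σ * σ = 1 := by rcases hσ with h | h <;> rw [h] <;> norm_num
  have hn : (0 : ℝ) < n + 1 := by positivity
  let φ : ℝ → ℝ := fun x => binomExp (q + σ * (x / (n + 1))) (n + 1) (testStat n q)
  let θ : ℝ → ℝ := fun x => 1 / (4 * w) *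
    (x - ((u ^ 2 + D + 1 / 12) * x - x ^ 2 / 2 + x ^ 3 / 3) / (9 * w ^ 2))
  have hφ : ∀ x, HasDerivAt φ ((((n : ℝ) + 1) *
      binomExp (q + σ * (x / (n + 1))) n (fun j => testStat n q (j + 1) - testStat n q j)) *
        (σ * (1 / (n + 1)))) x := fun x =>
    (hasDerivAt_binomExp n (testStat n q) _).comp x
      ((((hasDerivAt_id x).div_const _).const_mul σ).const_add q)
  have hθ : ∀ x, HasDerivAt θ (1 / (4 * w) *
      (1 - ((u ^ 2 + D + 1 / 12) - x + x ^ 2) / (9 * w ^ 2))) x := by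
    intro x
    have h := (((hasDerivAt_id x).sub (((((hasDerivAt_id x).const_mul (u ^ 2 + D + 1 / 12)).sub
      ((hasDerivAt_pow 2 x).div_const 2)).add
        ((hasDerivAt_pow 3 x).div_const 3)).div_const (9 * w ^ 2))).const_mul (1 / (4 * w)))
    refine h.congr_deriv ?_
    push_cast
    ring
  have hmono : MonotoneOn (fun x => σ * φ x - θ x) (Set.Icc 0 D) := by
    have hd : ∀ x, HasDerivAt (fun x => σ * φ x - θ x) _ x :=
      fun x => ((hφ x).const_mul σ).sub (hθ x)
    refine monotoneOn_of_deriv_nonneg (convex_Icc 0 D)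
      (fun x _ => (hd x).continuousAt.continuousWithinAt)
      (fun x _ => (hd x).differentiableAt.differentiableWithinAt) ?_
    intro x hx
    rw [interior_Icc] at hx
    rw [(hd x).deriv]
    set r := q + σ * (x / (n + 1)) with hr
    have hxD : x / (n + 1) ≤ D / (n + 1) := by gcongr; exact hx.2.le
    have hx0 : 0 ≤ x / (n + 1) := div_nonneg hx.1.le hn.le
    have hr01 : 0 ≤ r ∧ r ≤ 1 := by
      rcases hσ with h | h <;> rw [h] at hr hq' <;> constructor <;> linarith
    have hrq' : |r - q'| = (D - x) / (n + 1) := by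
      have : r - q' = -σ * ((D - x) / (n + 1)) := by rw [hr, hq']; ring
      have hσa : |-σ| = 1 := by rcases hσ with h | h <;> rw [h] <;> norm_num
      rw [this, abs_mul, hσa, one_mul, abs_of_nonneg (div_nonneg (by linarith [hx.2]) hn.le)]
    have hv := variance_sub_le (n + 1) hr01.1 hr01.2 hq'0 hq'1
    rw [hrq'] at hv
    push_cast at hv hw'
    rw [mul_div_cancel₀ _ hn.ne'] at hv
    have hvn : n * r * (1 - r) ≤ (n + 1) * r * (1 - r) := by
      nlinarith [mul_nonneg hr01.1 (sub_nonneg.mpr hr01.2)]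
    have hnx : (n * r - n * q) ^ 2 ≤ x ^ 2 := by
      have e : n * r - n * q = σ * (n / (n + 1) * x) := by rw [hr]; ring
      rw [e, mul_pow, sq σ, hσ2, one_mul, mul_pow]
      refine mul_le_of_le_one_left (sq_nonneg x) (pow_le_one₀ (by positivity) ?_)
      rw [div_le_one hn]; linarith
    have hge := binomExp_testStat_succ_sub_ge n (q := q) hr01.1 hr01.2
    rw [← hwdef] at hge
    have hcmp : 1 / (4 * w) * (1 - ((u ^ 2 + D + 1 / 12) - x + x ^ 2) / (9 * w ^ 2)) ≤
        1 / (4 * w) * (1 - (n * r * (1 - r) + (n * r - n * q) ^ 2 + 1 / 12) / (9 * w ^ 2)) := by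
      refine mul_le_mul_of_nonneg_left (sub_le_sub_left
        (div_le_div_of_nonneg_right ?_ (by positivity)) _) (by positivity)
      linarith
    have e : ∀ y : ℝ, σ * ((((n : ℝ) + 1) * y) * (σ * (1 / (n + 1)))) = y := by
      intro y
      field_simp
      linear_combination y * hσ2
    rw [e]
    linarith
  have h := hmono (Set.left_mem_Icc.mpr hD) (Set.right_mem_Icc.mpr hD) hD
  have e0 : φ 0 = binomExp q (n + 1) (testStat n q) := by simp [φ]
  have e1 : φ D = binomExp q' (n + 1) (testStat n q) := by simp only [φ, ← hq']
  simp only [e0, e1] at h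
  have t0 : θ 0 = 0 := by simp [θ]
  have t1 : θ D = D / (4 * w) *
      (1 - (u ^ 2 + D / 2 + D ^ 2 / 3 + 1 / 12) / (9 * w ^ 2)) := by
    simp only [θ]; field_simp; ring
  rw [t0, t1] at h
  linarith

theorem gain_ge_of_width_bounds {u w a : ℝ} (hu : 1 ≤ u) (hw : 1 ≤ w) (ha0 : 0 ≤ a)
    (ha1 : a ≤ 1) (h1 : w ^ 2 ≤ u ^ 2 + 0.9 * a * u) (h2 : u ^ 2 ≤ w ^ 2 + 0.9 * a * u) :
    a * (1 / 8 + 0.3 * (u ^ 2 / (16 * w ^ 2))) ≤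
      0.9 * a * u / (4 * w) *
        (1 - (u ^ 2 + 0.9 * a * u / 2 + (0.9 * a * u) ^ 2 / 3 + 1 / 12) / (9 * w ^ 2)) := by
  have hau : a * u ≤ u := mul_le_of_le_one_left (by linarith) ha1
  have hau0 : 0 ≤ a * u := mul_nonneg ha0 (by linarith)
  have hQ : u ^ 2 + 0.9 * a * u / 2 + (0.9 * a * u) ^ 2 / 3 + 1 / 12 ≤ 1.804 * u ^ 2 := by
    nlinarith
  have hz1 : 0.646 * u ≤ w := by
    by_contra hc
    push Not at hc
    nlinarith
  have hz2 : w ≤ 1.379 * u := by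
    by_contra hc
    push Not at hc
    nlinarith
  have hpoly : 0 ≤ 8.1 * u * w ^ 2 - 1.6236 * u ^ 3 - 4.5 * w ^ 3 - 0.675 * u ^ 2 * w := by
    nlinarith [mul_nonneg (mul_nonneg (sub_nonneg.mpr hz1) (sub_nonneg.mpr hz2))
      (by linarith : 0 ≤ u), mul_nonneg (mul_nonneg (sub_nonneg.mpr hz1) (sub_nonneg.mpr hz2))
      (by linarith : 0 ≤ w), mul_nonneg (sub_nonneg.mpr hz1) (sq_nonneg u),
      mul_nonneg (sub_nonneg.mpr hz2) (sq_nonneg u)]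
  have hfac : 1 / 8 + 0.3 * (u ^ 2 / (16 * w ^ 2)) ≤
      0.9 * u / (4 * w) * (1 - 1.804 * u ^ 2 / (9 * w ^ 2)) := by
    have e : 0.9 * u / (4 * w) * (1 - 1.804 * u ^ 2 / (9 * w ^ 2)) -
        (1 / 8 + 0.3 * (u ^ 2 / (16 * w ^ 2))) =
        (8.1 * u * w ^ 2 - 1.6236 * u ^ 3 - 4.5 * w ^ 3 - 0.675 * u ^ 2 * w) / (36 * w ^ 3) := by
      field_simp
      ring
    have := div_nonneg hpoly (by positivity : 0 ≤ 36 * w ^ 3)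
    linarith
  calc a * (1 / 8 + 0.3 * (u ^ 2 / (16 * w ^ 2)))
      ≤ a * (0.9 * u / (4 * w) * (1 - 1.804 * u ^ 2 / (9 * w ^ 2))) := by gcongr
    _ = 0.9 * a * u / (4 * w) * (1 - 1.804 * u ^ 2 / (9 * w ^ 2)) := by ring
    _ ≤ _ := by gcongr

/-- Exponential moment of the test at `q` under `Bin(n+1,p)` with `p` far from `q`. -/
theorem binomExp_exp_testStat_le (n : ℕ) {p q σ t a l : ℝ} (hσ : σ = 1 ∨ σ = -1)
    (ht : 0 ≤ t) (hq0 : 0 ≤ q) (hq1 : q ≤ 1) (hp0 : 0 ≤ p) (hp1 : p ≤ 1) (hp : p = q + σ * t)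
    (ha0 : 0 < a) (ha1 : a ≤ 1) (hl0 : 0 ≤ l) (hla : l ≤ a / 2)
    (hfar : 0.9 * a * binomWidth (n + 1) p ≤ (n + 1) * t) :
    binomExp p (n + 1)
        (fun j => Real.exp (-σ * l * (testStat n q j - binomExp q (n + 1) (testStat n q)))) ≤
      Real.exp (-(l * a / 8)) := by
  have hn : (0 : ℝ) < n + 1 := by positivity
  obtain ⟨x, hx, hxe⟩ : ∃ x ∈ Set.Icc 0 t,
      (n + 1) * x - 0.9 * a * binomWidth (n + 1) (q + σ * x) = 0 := by
    have hc : ContinuousOn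
        (fun x => (n + 1) * x - 0.9 * a * binomWidth (n + 1) (q + σ * x)) (Set.Icc 0 t) := by
      have := continuous_binomWidth (n + 1)
      fun_prop
    refine intermediate_value_Icc ht hc ⟨?_, ?_⟩
    · have := binomWidth_pos (n + 1) (q + σ * 0)
      have : 0 ≤ 0.9 * a * binomWidth (n + 1) (q + σ * 0) := by positivity
      linarith
    · simp only [← hp]; linarith
  set q' := q + σ * x with hq'
  set u := binomWidth (n + 1) q' with hu
  set w := binomWidth (n + 1) q with hw
  set τ := binomExp q (n + 1) (testStat n q) with hτ
  have hD : (n + 1) * x = 0.9 * a * u := by linarith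
  have hq'01 : 0 ≤ q' ∧ q' ≤ 1 := by
    rcases hσ with h | h <;> rw [h] at hq' hp <;> constructor <;> linarith [hx.1, hx.2]
  have habs : |q' - q| = x := by
    rw [hq', add_sub_cancel_left, abs_mul, abs_of_nonneg hx.1]
    rcases hσ with h | h <;> rw [h] <;> norm_num
  have h1 := binomWidth_sq_le (n + 1) hq0 hq1 hq'01.1 hq'01.2
  have h2 := binomWidth_sq_le (n + 1) hq'01.1 hq'01.2 hq0 hq1
  rw [abs_sub_comm, habs] at h1
  rw [habs] at h2
  push_cast at h1 h2
  rw [hD, ← hw, ← hu] at h1 h2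
  have hgain := binomExp_testStat_gain n (q := q) (q' := q') (D := 0.9 * a * u) hσ
    (by have := binomWidth_pos (n + 1) q'; positivity) hq0 hq1
    (by rw [hq', ← hD]; field_simp) hq'01.1 hq'01.2
  rw [← hu, ← hw, ← hτ] at hgain
  have hnum := gain_ge_of_width_bounds (one_le_binomWidth (n + 1) q')
    (one_le_binomWidth (n + 1) q) ha0.le ha1 h1 h2
  have hvar := binomExp_testStat_variance_le n (q := q) hq'01.1 hq'01.2
  rw [← hu, ← hw] at hvar
  have hσabs : |-σ * l| = l := by
    rw [abs_mul, abs_of_nonneg hl0]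
    rcases hσ with h | h <;> rw [h] <;> norm_num
  have hexp := binomExp_exp_le hq'01.1 hq'01.2 (n + 1) (testStat n q)
    (fun _ => smoothStep_nonneg _) (fun _ => smoothStep_le_one _) (-σ * l)
    (by rw [hσabs]; linarith)
  have hcomp : binomExp p (n + 1) (fun j => Real.exp (-σ * l * testStat n q j)) ≤
      binomExp q' (n + 1) (fun j => Real.exp (-σ * l * testStat n q j)) := by
    rcases hσ with h | h
    · subst h
      have hm := monotoneOn_binomExp (n + 1)
        (g := fun j => (-1) * Real.exp (-1 * l * testStat n q j)) (by
          intro i j hij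
          have := mul_le_mul_of_nonneg_left (testStat_mono n q hij) hl0
          have : Real.exp (-1 * l * testStat n q j) ≤ Real.exp (-1 * l * testStat n q i) :=
            Real.exp_le_exp.mpr (by linarith)
          simp only; linarith) (Set.mem_Icc.mpr hq'01) (Set.mem_Icc.mpr ⟨hp0, hp1⟩)
        (by rw [hq', hp]; linarith [hx.2])
      simp only [binomExp_const_mul] at hm
      linarith
    · subst h
      exact monotoneOn_binomExp (n + 1)
        (g := fun j => Real.exp (- -1 * l * testStat n q j)) (by
          intro i j hij
          have := mul_le_mul_of_nonneg_left (testStat_mono n q hij) hl0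
          exact Real.exp_le_exp.mpr (by linarith)) (Set.mem_Icc.mpr ⟨hp0, hp1⟩)
        (Set.mem_Icc.mpr hq'01) (by rw [hq', hp]; linarith [hx.2])
  have hsplit : (fun j => Real.exp (-σ * l * (testStat n q j - τ))) =
      fun j => Real.exp (σ * l * τ) * Real.exp (-σ * l * testStat n q j) := by
    funext j; rw [← Real.exp_add]; ring_nf
  rw [hsplit, binomExp_const_mul]
  refine (mul_le_mul_of_nonneg_left (hcomp.trans hexp) (Real.exp_pos _).le).trans ?_
  rw [← Real.exp_add, Real.exp_le_exp]
  set V := binomExp q' (n + 1)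
    (fun j => (testStat n q j - binomExp q' (n + 1) (testStat n q)) ^ 2)
  set μ := binomExp q' (n + 1) (testStat n q)
  have hσ2 : (-σ * l) ^ 2 = l ^ 2 := by rcases hσ with h | h <;> rw [h] <;> ring
  have hV : 0.6 * l ^ 2 * V ≤ 0.3 * l * a * (u ^ 2 / (16 * w ^ 2)) := by
    have : 0 ≤ u ^ 2 / (16 * w ^ 2) := by positivity
    have h3 : l ^ 2 ≤ l * a / 2 := by nlinarith
    calc 0.6 * l ^ 2 * V ≤ 0.6 * l ^ 2 * (u ^ 2 / (16 * w ^ 2)) := by gcongr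
      _ ≤ 0.6 * (l * a / 2) * (u ^ 2 / (16 * w ^ 2)) := by gcongr
      _ = _ := by ring
  have hg := mul_le_mul_of_nonneg_left (hnum.trans hgain) hl0
  rw [hσ2]
  linarith

/-! ### Integrals over samples -/

theorem binomPMF_nonneg {m : ℕ} {p : ℝ} (h0 : 0 ≤ p) (h1 : p ≤ 1) (j : ℕ) :
    0 ≤ binomPMF m p j := by
  have := sub_nonneg.mpr h1
  unfold binomPMF
  positivity

theorem lintegral_binMeasure {m : ℕ} {p : ℝ} (h0 : 0 ≤ p) (h1 : p ≤ 1) {g : ℕ → ℝ}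
    (hg : ∀ j, 0 ≤ g j) :
    ∫⁻ j, ENNReal.ofReal (g j) ∂(binMeasure m p) = ENNReal.ofReal (binomExp p m g) := by
  have hpmf := binomPMF_nonneg (m := m) h0 h1
  simp only [binMeasure, lintegral_finsetSum_measure, lintegral_smul_measure, lintegral_dirac,
    smul_eq_mul, ← ENNReal.ofReal_mul (hpmf _)]
  rw [← ENNReal.ofReal_sum_of_nonneg fun j _ => mul_nonneg (hpmf _) (hg _),
    Fin.sum_univ_eq_sum_range (fun j => binomPMF m p j * g j), sum_binomPMF_mul]

theorem isProbabilityMeasure_binMeasure {m : ℕ} {p : ℝ} (h0 : 0 ≤ p) (h1 : p ≤ 1) :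
    IsProbabilityMeasure (binMeasure m p) := by
  constructor
  have h := lintegral_binMeasure (m := m) h0 h1 (g := fun _ => 1) (fun _ => zero_le_one)
  simpa [binomExp_const] using h

theorem lintegral_pi_prod {ι X : Type*} [Fintype ι] [DecidableEq ι] [Fintype X]
    [MeasurableSpace X] [MeasurableSingletonClass X] (μ : Measure X) [SigmaFinite μ]
    (g : X → ℝ≥0∞) :
    ∫⁻ D, ∏ v, g (D v) ∂(Measure.pi fun _ : ι => μ) = (∫⁻ x, g x ∂μ) ^ Fintype.card ι := by
  rw [lintegral_fintype, lintegral_fintype]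
  simp only [Measure.pi_singleton, ← Finset.prod_mul_distrib]
  have h := Finset.prod_univ_sum (fun _ : ι => (Finset.univ : Finset X))
    (fun _ x => g x * μ {x})
  rw [Fintype.piFinset_univ, Finset.prod_const, Finset.card_univ] at h
  exact h.symm

/-! ### The inverse sensitivity mechanism -/

section InverseSensitivity

variable {ι X O Y : Type*} [Fintype ι] [DecidableEq X]

/-- The weight of output `i`, decaying with the number of samples of `D` that must be changed
for the estimator `f` to return `i`. -/
noncomputable def invSensWeight (f : (ι → X) → O) (c : ℝ) (D : ι → X) (i : O) : ℝ≥0∞ :=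
  ⨆ D', ⨆ _ : f D' = i, ENNReal.ofReal (Real.exp (-c * hammingDist D D'))

theorem invSensWeight_le_one (f : (ι → X) → O) {c : ℝ} (hc : 0 ≤ c) (D : ι → X) (i : O) :
    invSensWeight f c D i ≤ 1 := by
  refine iSup₂_le fun D' _ => ENNReal.ofReal_le_one.mpr (Real.exp_le_one_iff.mpr ?_)
  have : 0 ≤ c * hammingDist D D' := by positivity
  linarith

theorem one_le_invSensWeight_self (f : (ι → X) → O) (c : ℝ) (D : ι → X) :
    1 ≤ invSensWeight f c D (f D) := by
  refine le_trans (by simp) (le_iSup₂ (f := fun D' (_ : f D' = f D) =>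
    ENNReal.ofReal (Real.exp (-c * hammingDist D D'))) D rfl)

theorem invSensWeight_le_mul (f : (ι → X) → O) {c : ℝ} (hc : 0 ≤ c) {D D' : ι → X}
    (h : hammingDist D D' ≤ 1) (i : O) :
    invSensWeight f c D i ≤ ENNReal.ofReal (Real.exp c) * invSensWeight f c D' i := by
  refine iSup₂_le fun E hE => ?_
  refine le_trans ?_ (mul_le_mul_right (le_iSup₂ (f := fun E (_ : f E = i) =>
    ENNReal.ofReal (Real.exp (-c * hammingDist D' E))) E hE) _)
  rw [← ENNReal.ofReal_mul (Real.exp_pos _).le, ← Real.exp_add]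
  refine ENNReal.ofReal_le_ofReal (Real.exp_le_exp.mpr ?_)
  have h1 : hammingDist D' E ≤ 1 + hammingDist D E :=
    (hammingDist_triangle D' D E).trans (by rw [hammingDist_comm D' D]; omega)
  have h2 : (hammingDist D' E : ℝ) ≤ 1 + hammingDist D E := by exact_mod_cast h1
  nlinarith

theorem invSensWeight_le_exp (f : (ι → X) → O) {c l T : ℝ} (hl : 0 ≤ l) (hlc : l ≤ c)
    {D : ι → X} {i : O} (h : ∀ D', f D' = i → -T ≤ hammingDist D D') :
    invSensWeight f c D i ≤ ENNReal.ofReal (Real.exp (l * T)) := by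
  refine iSup₂_le fun D' hD' => ENNReal.ofReal_le_ofReal (Real.exp_le_exp.mpr ?_)
  have h1 := mul_le_mul_of_nonneg_left (h D' hD') hl
  have h2 := mul_le_mul_of_nonneg_right hlc (Nat.cast_nonneg (α := ℝ) (hammingDist D D'))
  linarith

variable [Fintype O] [MeasurableSpace Y]

/-- The mechanism sampling `i` with probability proportional to its weight and returning `o i`. -/
noncomputable def invSensMechanism (f : (ι → X) → O) (c : ℝ) (o : O → Y) (D : ι → X) :
    Measure Y :=
  ∑ i, (invSensWeight f c D i / ∑ j, invSensWeight f c D j) • Measure.dirac (o i)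

theorem one_le_sum_invSensWeight (f : (ι → X) → O) (c : ℝ) (D : ι → X) :
    1 ≤ ∑ j, invSensWeight f c D j :=
  (one_le_invSensWeight_self f c D).trans
    (Finset.single_le_sum (f := invSensWeight f c D) (fun _ _ => zero_le)
      (Finset.mem_univ (f D)))

theorem sum_invSensWeight_ne_top (f : (ι → X) → O) {c : ℝ} (hc : 0 ≤ c) (D : ι → X) :
    ∑ j, invSensWeight f c D j ≠ ∞ :=
  ENNReal.sum_ne_top.mpr fun i _ =>
    ((invSensWeight_le_one f hc D i).trans_lt ENNReal.one_lt_top).ne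

theorem invSensMechanism_apply (f : (ι → X) → O) (c : ℝ) (o : O → Y) (D : ι → X) {S : Set Y}
    (hS : MeasurableSet S) :
    invSensMechanism f c o D S =
      ∑ i, invSensWeight f c D i / (∑ j, invSensWeight f c D j) * S.indicator 1 (o i) := by
  simp [invSensMechanism, Measure.dirac_apply' _ hS]

theorem isProbabilityMeasure_invSensMechanism (f : (ι → X) → O) {c : ℝ} (hc : 0 ≤ c)
    (o : O → Y) (D : ι → X) : IsProbabilityMeasure (invSensMechanism f c o D) := by
  constructor
  rw [invSensMechanism_apply _ _ _ _ MeasurableSet.univ]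
  simp only [Set.indicator_univ, Pi.one_apply, mul_one, div_eq_mul_inv, ← Finset.sum_mul]
  exact ENNReal.mul_inv_cancel
    (one_pos.trans_le (one_le_sum_invSensWeight f c D)).ne' (sum_invSensWeight_ne_top f hc D)

theorem invSensMechanism_le (f : (ι → X) → O) {c : ℝ} (hc : 0 ≤ c) (o : O → Y)
    {D D' : ι → X} (h : hammingDist D D' ≤ 1) {S : Set Y} (hS : MeasurableSet S) :
    invSensMechanism f c o D S ≤
      ENNReal.ofReal (Real.exp (2 * c)) * invSensMechanism f c o D' S := by
  rw [invSensMechanism_apply _ _ _ _ hS, invSensMechanism_apply _ _ _ _ hS, Finset.mul_sum]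
  refine Finset.sum_le_sum fun i _ => ?_
  rw [← mul_assoc]
  refine mul_le_mul_left ?_ _
  set e := ENNReal.ofReal (Real.exp c) with he
  have he0 : e ≠ 0 := (ENNReal.ofReal_pos.mpr (Real.exp_pos c)).ne'
  have hee : ENNReal.ofReal (Real.exp (2 * c)) = e * e := by
    rw [he, ← ENNReal.ofReal_mul (Real.exp_pos _).le, ← Real.exp_add, two_mul]
  have hZ : ∑ j, invSensWeight f c D' j ≤ e * ∑ j, invSensWeight f c D j := by
    rw [Finset.mul_sum]
    exact Finset.sum_le_sum fun j _ =>
      invSensWeight_le_mul f hc (by rwa [hammingDist_comm]) j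
  have hinv : (∑ j, invSensWeight f c D j)⁻¹ ≤ e * (∑ j, invSensWeight f c D' j)⁻¹ := by
    have h1 := ENNReal.inv_le_inv.mpr hZ
    rw [ENNReal.mul_inv (Or.inl he0) (Or.inl ENNReal.ofReal_ne_top)] at h1
    have h2 := mul_le_mul_right h1 e
    rwa [← mul_assoc, ENNReal.mul_inv_cancel he0 ENNReal.ofReal_ne_top, one_mul] at h2
  rw [div_eq_mul_inv, div_eq_mul_inv, hee]
  refine (mul_le_mul' (invSensWeight_le_mul f hc h i) hinv).trans_eq ?_
  ring

theorem invSensMechanism_apply_le (f : (ι → X) → O) (c : ℝ) (o : O → Y) (D : ι → X)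
    {S : Set Y} (hS : MeasurableSet S) :
    invSensMechanism f c o D S ≤ ∑ i, invSensWeight f c D i * S.indicator 1 (o i) := by
  rw [invSensMechanism_apply _ _ _ _ hS]
  refine Finset.sum_le_sum fun i _ => mul_le_mul_left ?_ _
  exact ENNReal.div_le_of_le_mul
    (le_mul_of_one_le_right' (one_le_sum_invSensWeight f c D))

end InverseSensitivity

theorem sum_sub_sum_le_hammingDist {ι X : Type*} [Fintype ι] [DecidableEq X] {g : X → ℝ}
    (h0 : ∀ x, 0 ≤ g x) (h1 : ∀ x, g x ≤ 1) (D D' : ι → X) :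
    ∑ v, g (D v) - ∑ v, g (D' v) ≤ hammingDist D D' := by
  rw [hammingDist, Finset.card_filter, ← Finset.sum_sub_distrib]
  push_cast
  refine Finset.sum_le_sum fun v _ => ?_
  split_ifs with h
  · linarith [h0 (D' v), h1 (D v)]
  · push Not at h
    rw [h, sub_self]

theorem hammingDist_le_one {ι X : Type*} [Fintype ι] [DecidableEq X] {D D' : ι → X} {u : ι}
    (h : ∀ v, v ≠ u → D v = D' v) : hammingDist D D' ≤ 1 := by
  refine (Finset.card_le_card (t := {u}) fun v hv => ?_).trans_eq (Finset.card_singleton u)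
  by_contra hne
  exact (Finset.mem_filter.mp hv).2 (h v (by simpa using hne))

/-- The centred sum of the test statistics at `q` over a dataset. -/
noncomputable def testSum {s : ℕ} (n : ℕ) (q : ℝ) (D : Fin s → Fin (n + 1 + 1)) : ℝ :=
  ∑ v, (testStat n q (D v) - binomExp q (n + 1) (testStat n q))

theorem testSum_sub_le {s : ℕ} (n : ℕ) (q : ℝ) (D D' : Fin s → Fin (n + 1 + 1)) :
    testSum n q D - testSum n q D' ≤ hammingDist D D' := by
  have h := sum_sub_sum_le_hammingDist (g := fun x : Fin (n + 1 + 1) => testStat n q x)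
    (fun _ => smoothStep_nonneg _) (fun _ => smoothStep_le_one _) D D'
  simp only [testSum, Finset.sum_sub_distrib]
  linarith

theorem lintegral_exp_testSum_le {s : ℕ} (n : ℕ) {p q σ t a l : ℝ} (hσ : σ = 1 ∨ σ = -1)
    (ht : 0 ≤ t) (hq0 : 0 ≤ q) (hq1 : q ≤ 1) (hp0 : 0 ≤ p) (hp1 : p ≤ 1) (hp : p = q + σ * t)
    (ha0 : 0 < a) (ha1 : a ≤ 1) (hl0 : 0 ≤ l) (hla : l ≤ a / 2)
    (hfar : 0.9 * a * binomWidth (n + 1) p ≤ (n + 1) * t) :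
    ∫⁻ D, ENNReal.ofReal (Real.exp (l * (-σ * testSum n q D)))
        ∂(Measure.pi fun _ : Fin s => binMeasure (n + 1) p) ≤
      ENNReal.ofReal (Real.exp (-(s * (l * a / 8)))) := by
  have := isProbabilityMeasure_binMeasure (m := n + 1) hp0 hp1
  have hprod : ∀ D : Fin s → Fin (n + 1 + 1),
      ENNReal.ofReal (Real.exp (l * (-σ * testSum n q D))) =
        ∏ v, ENNReal.ofReal
          (Real.exp (-σ * l * (testStat n q (D v) - binomExp q (n + 1) (testStat n q)))) := by
    intro D
    rw [← ENNReal.ofReal_prod_of_nonneg fun v _ => (Real.exp_pos _).le, ← Real.exp_sum,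
      ← Finset.mul_sum, testSum, ← mul_assoc, mul_comm l]
  simp only [hprod]
  rw [lintegral_pi_prod (binMeasure (n + 1) p) (fun x => ENNReal.ofReal
      (Real.exp (-σ * l * (testStat n q x - binomExp q (n + 1) (testStat n q))))),
    lintegral_binMeasure hp0 hp1 (g := fun j =>
      Real.exp (-σ * l * (testStat n q j - binomExp q (n + 1) (testStat n q))))
      (fun _ => (Real.exp_pos _).le), Fintype.card_fin]
  have hle := binomExp_exp_testStat_le n hσ ht hq0 hq1 hp0 hp1 hp ha0 ha1 hl0 hla hfar
  refine (pow_le_pow_left₀ zero_le (ENNReal.ofReal_le_ofReal hle) s).trans_eq ?_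
  rw [← ENNReal.ofReal_pow (Real.exp_pos _).le, ← Real.exp_nat_mul]
  ring_nf

/-- The largest grid index whose test accepts, or `0` if there is none. -/
theorem exists_threshold_estimator {Δ : Type*} (T : ℕ → Δ → ℝ) (N : ℕ) :
    ∃ f : Δ → Fin (N + 1), (∀ D, (f D : ℕ) ≠ 0 → 0 ≤ T (f D) D) ∧
      ∀ D (j : ℕ), (f D : ℕ) < j → j ≤ N → T j D < 0 := by
  classical
  refine ⟨fun D => ⟨Nat.findGreatest (fun i => 0 ≤ T i D) N,
    Nat.lt_succ_of_le (Nat.findGreatest_le N)⟩, fun D hD => ?_, fun D j hj hjN => ?_⟩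
  · exact Nat.findGreatest_of_ne_zero (P := fun i => 0 ≤ T i D) rfl hD
  · exact not_le.mp (Nat.findGreatest_is_greatest (P := fun i => 0 ≤ T i D) hj hjN)

theorem max_div_eq_binomWidth_div {m : ℕ} (hm : 1 ≤ m) {p : ℝ} :
    max (1 / (m : ℝ)) (Real.sqrt (p * (1 - p)) / Real.sqrt m) = binomWidth m p / m := by
  have hm0 : (0 : ℝ) < m := by exact_mod_cast hm
  have hs : 0 < Real.sqrt m := Real.sqrt_pos.mpr hm0
  rw [binomWidth, ← max_div_div_right hm0.le, mul_assoc, Real.sqrt_mul hm0.le]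
  congr 1
  rw [div_eq_div_iff hs.ne' hm0.ne']
  linear_combination -Real.sqrt (p * (1 - p)) * Real.mul_self_sqrt hm0.le

/-- The grid point `i/N` of `[0,1]`. -/
noncomputable def gridPoint (N : ℕ) (i : Fin (N + 1)) : {x : ℝ // 0 ≤ x ∧ x ≤ 1} :=
  ⟨(i : ℕ) / (N : ℝ), by positivity, div_le_one_of_le₀
    (by exact_mod_cast Nat.lt_succ_iff.mp i.isLt) (Nat.cast_nonneg N)⟩

/-- Each far grid point is output with exponentially small expected weight. -/
theorem lintegral_invSensWeight_le {s n N : ℕ} {α l c p : ℝ} (hα0 : 0 < α) (hα1 : α < 1)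
    (hl0 : 0 ≤ l) (hlα : l ≤ α / 2) (hlc : l ≤ c) (hN : 10 * (n + 1) / α ≤ N)
    {f : (Fin s → Fin (n + 1 + 1)) → Fin (N + 1)}
    (hf0 : ∀ D, (f D : ℕ) ≠ 0 → 0 ≤ testSum n ((f D : ℕ) / (N : ℝ)) D)
    (hf1 : ∀ D (j : ℕ), (f D : ℕ) < j → j ≤ N → testSum n ((j : ℝ) / N) D < 0)
    (hp0 : 0 ≤ p) (hp1 : p ≤ 1) (i : Fin (N + 1))
    (hi : α * binomWidth (n + 1) p / (n + 1) < |p - (i : ℕ) / (N : ℝ)|) :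
    ∫⁻ D, invSensWeight f c D i ∂(Measure.pi fun _ : Fin s => binMeasure (n + 1) p) ≤
      ENNReal.ofReal (Real.exp (-(s * (l * α / 8)))) := by
  have hn : (0 : ℝ) < n + 1 := by positivity
  have hN0 : (0 : ℝ) < N := lt_of_lt_of_le (by positivity) hN
  have hw := one_le_binomWidth (n + 1) p
  rw [div_lt_iff₀ hn] at hi
  rcases le_total p ((i : ℕ) / (N : ℝ)) with hpi | hpi
  · rw [abs_of_nonpos (by linarith)] at hi
    refine le_trans (lintegral_mono fun D => ?_)
      (lintegral_exp_testSum_le (s := s) n (p := p) (q := (i : ℕ) / (N : ℝ)) (σ := -1)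
        (t := (i : ℕ) / (N : ℝ) - p) (Or.inr rfl) (by linarith) (gridPoint N i).2.1
        (gridPoint N i).2.2 hp0 hp1 (by ring) hα0 hα1.le hl0 hlα (by nlinarith))
    refine invSensWeight_le_exp f hl0 hlc fun D' hD' => ?_
    have hi0 : (i : ℕ) ≠ 0 := by
      intro h0
      rw [h0, Nat.cast_zero, zero_div] at hi
      nlinarith [mul_pos hα0 (binomWidth_pos (n + 1) p)]
    have h1 := hf0 D' (by rwa [hD'])
    rw [hD'] at h1
    have h2 := testSum_sub_le n ((i : ℕ) / (N : ℝ)) D' D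
    rw [hammingDist_comm] at h2
    linarith
  · rw [abs_of_nonneg (by linarith)] at hi
    have hiN : (i : ℕ) + 1 ≤ N := by
      by_contra hc
      have hiN : (i : ℕ) = N := by have := i.isLt; omega
      rw [hiN, div_self hN0.ne'] at hi
      nlinarith [mul_pos hα0 (binomWidth_pos (n + 1) p)]
    have hstep : (n + 1) * (1 / (N : ℝ)) ≤ 0.1 * α := by
      rw [div_le_iff₀ hα0] at hN
      rw [mul_one_div, div_le_iff₀ hN0]
      linarith
    have hq : (((i : ℕ) + 1 : ℕ) : ℝ) / N = (i : ℕ) / (N : ℝ) + 1 / N := by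
      push_cast; ring
    have hfar : 0.9 * α * binomWidth (n + 1) p ≤
        (n + 1) * (p - (((i : ℕ) + 1 : ℕ) : ℝ) / N) := by
      rw [hq]; nlinarith
    have ht : 0 ≤ p - (((i : ℕ) + 1 : ℕ) : ℝ) / N := by
      have : 0 ≤ 0.9 * α * binomWidth (n + 1) p := by positivity
      exact nonneg_of_mul_nonneg_right (this.trans hfar) hn
    refine le_trans (lintegral_mono fun D => ?_)
      (lintegral_exp_testSum_le (s := s) n (p := p) (q := (((i : ℕ) + 1 : ℕ) : ℝ) / N) (σ := 1)
        (t := p - (((i : ℕ) + 1 : ℕ) : ℝ) / N) (Or.inl rfl) ht (by positivity) (by linarith)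
        hp0 hp1 (by ring) hα0 hα1.le hl0 hlα hfar)
    refine invSensWeight_le_exp f hl0 hlc fun D' hD' => ?_
    have h1 := hf1 D' ((i : ℕ) + 1) (by rw [hD']; omega) hiN
    have h2 := testSum_sub_le n ((((i : ℕ) + 1 : ℕ) : ℝ) / N) D D'
    linarith

/-- private learning of binomial distributions.  If
`s ≥ 16 log(20m/(αβ))/α² + 16 log(20m/(αβ))/(αε)`, then there is an (ε,0)-DP mechanism on
datasets of `s` samples in `{0,…,m}` returning `p̂ ∈ [0,1]` such that for every `p ∈ [0,1]`,
when the samples are i.i.d. `Bin(m,p)`, with probability at least `1-β` we have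
`|p - p̂| ≤ α max(1/m, √(p(1-p))/√m)`. -/
theorem stmt16 (m : ℕ) (hm : 1 ≤ m) (ε α β : ℝ) (hε : 0 < ε)
    (hα0 : 0 < α) (hα1 : α < 1) (hβ0 : 0 < β) (hβ1 : β < 1)
    (s : ℕ)
    (hs : 16 * Real.log (20 * m / (α * β)) / α ^ 2 +
          16 * Real.log (20 * m / (α * β)) / (α * ε) ≤ (s : ℝ)) :
    ∃ A : (Fin s → Fin (m + 1)) → Measure {x : ℝ // 0 ≤ x ∧ x ≤ 1},
      (∀ D, IsProbabilityMeasure (A D)) ∧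
      (∀ D D' : Fin s → Fin (m + 1), (∃ u, ∀ v, v ≠ u → D v = D' v) →
        ∀ S : Set {x : ℝ // 0 ≤ x ∧ x ≤ 1}, MeasurableSet S →
          A D S ≤ ENNReal.ofReal (Real.exp ε) * A D' S) ∧
      (∀ p : ℝ, 0 ≤ p → p ≤ 1 →
        ENNReal.ofReal (1 - β) ≤
          ∫⁻ D, A D {x | |p - (x : ℝ)| ≤
              α * max (1 / (m : ℝ)) (Real.sqrt (p * (1 - p)) / Real.sqrt m)}
            ∂(Measure.pi fun _ : Fin s => binMeasure m p)) := by
  obtain ⟨n, rfl⟩ : ∃ n, m = n + 1 := ⟨m - 1, by omega⟩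
  set N := ⌈10 * ((n : ℝ) + 1) / α⌉₊ with hNdef
  have hN : 10 * ((n : ℝ) + 1) / α ≤ N := Nat.le_ceil _
  obtain ⟨f, hf0, hf1⟩ := exists_threshold_estimator
    (fun i (D : Fin s → Fin (n + 1 + 1)) => testSum n ((i : ℝ) / N) D) N
  have hc : 0 ≤ ε / 2 := by positivity
  refine ⟨invSensMechanism f (ε / 2) (gridPoint N),
    isProbabilityMeasure_invSensMechanism f hc _, ?_, ?_⟩
  · rintro D D' ⟨u, hu⟩ S hS
    have h := invSensMechanism_le f hc (gridPoint N) (hammingDist_le_one hu) hS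
    rwa [mul_div_cancel₀ ε two_ne_zero] at h
  intro p hp0 hp1
  rw [max_div_eq_binomWidth_div hm]
  set B : Set {x : ℝ // 0 ≤ x ∧ x ≤ 1} :=
    {x | |p - (x : ℝ)| ≤ α * (binomWidth (n + 1) p / (n + 1 : ℕ))} with hB
  have hBm : MeasurableSet B := by
    refine (isClosed_le ?_ ?_).measurableSet <;> fun_prop
  have := isProbabilityMeasure_binMeasure (m := n + 1) hp0 hp1
  set P := Measure.pi fun _ : Fin s => binMeasure (n + 1) p with hP
  set l := α * ε / (2 * (α + ε)) with hl
  have hl0 : 0 ≤ l := by positivity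
  have hlα : l ≤ α / 2 := by
    rw [hl, div_le_div_iff₀ (by positivity) two_pos]
    nlinarith [mul_pos hα0 hα0]
  have hlε : l ≤ ε / 2 := by
    rw [hl, div_le_div_iff₀ (by positivity) two_pos]
    nlinarith [mul_pos hε hε]
  have hexp : Real.exp (-(s * (l * α / 8))) ≤ α * β / (20 * (n + 1)) := by
    have hlog : Real.log (20 * ((n + 1 : ℕ) : ℝ) / (α * β)) ≤ s * (l * α / 8) := by
      set L := Real.log (20 * ((n + 1 : ℕ) : ℝ) / (α * β))
      have h := mul_le_mul_of_nonneg_right hs (by positivity : 0 ≤ l * α / 8)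
      refine le_trans (le_of_eq ?_) h
      rw [hl]
      field_simp
      ring
    rw [Real.exp_neg, inv_le_comm₀ (Real.exp_pos _) (by positivity), inv_div]
    have hpos : 0 < 20 * ((n + 1 : ℕ) : ℝ) / (α * β) := by positivity
    have h := (Real.log_le_iff_le_exp hpos).mp hlog
    push_cast at h
    exact h
  have hbad : ∫⁻ D, invSensMechanism f (ε / 2) (gridPoint N) D Bᶜ ∂P ≤ ENNReal.ofReal β := by
    calc ∫⁻ D, invSensMechanism f (ε / 2) (gridPoint N) D Bᶜ ∂P
        ≤ ∫⁻ D, ∑ i, invSensWeight f (ε / 2) D i * Bᶜ.indicator 1 (gridPoint N i) ∂P :=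
          lintegral_mono fun D => invSensMechanism_apply_le f _ _ D hBm.compl
      _ = ∑ i, ∫⁻ D, invSensWeight f (ε / 2) D i * Bᶜ.indicator 1 (gridPoint N i) ∂P :=
          lintegral_finsetSum _ fun i _ => Measurable.of_discrete
      _ ≤ ∑ _i : Fin (N + 1), ENNReal.ofReal (α * β / (20 * (n + 1))) := by
          refine Finset.sum_le_sum fun i _ => ?_
          by_cases hi : gridPoint N i ∈ B
          · simp [hi]
          · have h := lintegral_invSensWeight_le hα0 hα1 hl0 hlα hlε hN hf0 hf1 hp0 hp1 i (by
              rw [hB, Set.mem_ofPred_eq, not_le] at hi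
              rw [mul_div_assoc]
              exact_mod_cast hi)
            simp only [Set.indicator_of_mem (Set.mem_compl hi), Pi.one_apply, mul_one]
            exact h.trans (ENNReal.ofReal_le_ofReal hexp)
      _ = ENNReal.ofReal ((N + 1) * (α * β / (20 * (n + 1)))) := by
          rw [Finset.sum_const, Finset.card_univ, Fintype.card_fin, nsmul_eq_mul,
            ENNReal.ofReal_mul (by positivity)]
          congr 1
          exact_mod_cast (ENNReal.ofReal_natCast (N + 1)).symm
      _ ≤ ENNReal.ofReal β := by
          refine ENNReal.ofReal_le_ofReal ?_
          have h1 : (N : ℝ) < 10 * (n + 1) / α + 1 := Nat.ceil_lt_add_one (by positivity)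
          have h2 : 10 ≤ 10 * ((n : ℝ) + 1) / α := by
            rw [le_div_iff₀ hα0]; nlinarith [Nat.cast_nonneg (α := ℝ) n]
          have h3 : (N : ℝ) + 1 ≤ 20 * (n + 1) / α := by
            have : 20 * ((n : ℝ) + 1) / α = 2 * (10 * (n + 1) / α) := by ring
            linarith
          calc (N + 1) * (α * β / (20 * (n + 1)))
              ≤ 20 * (n + 1) / α * (α * β / (20 * (n + 1))) := by gcongr
            _ = β := by field_simp
  have hprob := isProbabilityMeasure_invSensMechanism f hc (gridPoint N)
  have htotal : ∫⁻ D, invSensMechanism f (ε / 2) (gridPoint N) D B ∂P +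
      ∫⁻ D, invSensMechanism f (ε / 2) (gridPoint N) D Bᶜ ∂P = 1 := by
    rw [← lintegral_add_left Measurable.of_discrete]
    simp [measure_add_measure_compl hBm]
  rw [ENNReal.ofReal_sub _ hβ0.le, ENNReal.ofReal_one, ← htotal]
  exact tsub_le_iff_right.mpr (by gcongr)
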